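/- Let d ≥ 4 and G a connected graph on n > d vertices with independence number α(G) ≤ 5. If δ_{2t}(G) > t(d-2) for every integer t with 1 ≤ t ≤ α(G)/2, then G has a spanning tree whose leaf distance is at least d. -/

import Mathlib

/-- `I` is an independent set in `G`. -/
def IsIndepSet' {V : Type*} (G : SimpleGraph V) (I : Finset V) : Prop :=
  ∀ u ∈ I, ∀ v ∈ I, ¬G.Adj u v

/-- The neighborhood `N_G(I)` of a set of vertices `I`. -/
def nbhd {V : Type*} (G : SimpleGraph V) (I : Finset V) : Set V :=
  {v : V | ∃ u ∈ I, G.Adj u v}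

namespace LD
open SimpleGraph
variable {V : Type*}

/-- edges of `T` with both ends in `S` -/
def res (T : SimpleGraph V) (S : Set V) : SimpleGraph V where
  Adj a b := T.Adj a b ∧ a ∈ S ∧ b ∈ S
  symm := ⟨fun _ _ h => ⟨h.1.symm, h.2.2, h.2.1⟩⟩
  loopless := ⟨fun _ h => h.1.ne rfl⟩

/-- delete the edge `op` -/
def del (T : SimpleGraph V) (o p : V) : SimpleGraph V where
  Adj a b := T.Adj a b ∧ ¬ (a = o ∧ b = p) ∧ ¬ (a = p ∧ b = o)
  symm := ⟨fun _ _ h => ⟨h.1.symm, fun h' => h.2.2 ⟨h'.2, h'.1⟩, fun h' => h.2.1 ⟨h'.2, h'.1⟩⟩⟩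
  loopless := ⟨fun _ h => h.1.ne rfl⟩

/-- exchange: delete `op`, add `xv` -/
def sw (T : SimpleGraph V) (o p x v : V) : SimpleGraph V := del T o p ⊔ edge x v

lemma sw_adj {T : SimpleGraph V} {o p x v a b : V} : (sw T o p x v).Adj a b ↔
    (T.Adj a b ∧ ¬ (a = o ∧ b = p) ∧ ¬ (a = p ∧ b = o)) ∨
      ((a = x ∧ b = v ∨ a = v ∧ b = x) ∧ a ≠ b) := by
  simp only [sw, sup_adj, edge_adj]; rfl

lemma del_le (T : SimpleGraph V) (o p : V) : del T o p ≤ T := fun _ _ h => h.1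

lemma del_le_sw (T : SimpleGraph V) (o p x v : V) : del T o p ≤ sw T o p x v := le_sup_left

lemma del_eq (T : SimpleGraph V) (o p : V) : del T o p = T.deleteEdges {s(o,p)} := by
  ext a b
  simp only [del, deleteEdges_adj, Set.mem_singleton_iff, Sym2.eq_iff]
  tauto

lemma not_reach {T : SimpleGraph V} (hT : T.IsTree) {o p : V} (h : T.Adj o p) :
    ¬ (del T o p).Reachable o p := by
  have := isAcyclic_iff_forall_adj_isBridge.1 hT.isAcyclic h
  rw [isBridge_iff] at this
  rw [del_eq]; exact this

lemma res_le_del {T : SimpleGraph V} {S : Set V} {o p : V} (h : ¬ (o ∈ S ∧ p ∈ S)) :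
    res T S ≤ del T o p := by
  intro a b hab
  refine ⟨hab.1, ?_, ?_⟩
  · rintro ⟨rfl, rfl⟩; exact h hab.2
  · rintro ⟨rfl, rfl⟩; exact h ⟨hab.2.2, hab.2.1⟩

lemma res_le (T : SimpleGraph V) (S : Set V) : res T S ≤ T := fun _ _ h => h.1

lemma res_mono {T T' : SimpleGraph V} {S S' : Set V} (h : T ≤ T') (h' : S ⊆ S') :
    res T S ≤ res T' S' := fun _ _ hab => ⟨h hab.1, h' hab.2.1, h' hab.2.2⟩

lemma sw_connected {T : SimpleGraph V} (hT : T.IsTree) {o p x v : V} 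
    (hx : (del T o p).Reachable o x) (hv : (del T o p).Reachable p v) (hxv : x ≠ v) :
    (sw T o p x v).Connected := by
  have hop : (sw T o p x v).Reachable o p := by
    refine (hx.mono (del_le_sw ..)).trans (Reachable.trans ?_ (hv.mono (del_le_sw ..)).symm)
    exact Adj.reachable (sw_adj.2 (Or.inr ⟨Or.inl ⟨rfl, rfl⟩, hxv⟩))
  have := hT.connected.nonempty
  refine Connected.mk ?_
  intro a b
  obtain ⟨w⟩ := hT.connected a b
  induction w with
  | nil => exact Reachable.refl _
  | @cons u w' _ h _ ih =>
    refine Reachable.trans ?_ ih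
    by_cases h1 : u = o ∧ w' = p
    · rw [h1.1, h1.2]; exact hop
    by_cases h2 : u = p ∧ w' = o
    · rw [h2.1, h2.2]; exact hop.symm
    exact Adj.reachable (sw_adj.2 (Or.inl ⟨h, h1, h2⟩))

lemma sw_isTree {T : SimpleGraph V} (hT : T.IsTree) {o p x v : V} (h : T.Adj o p)
    (hx : (del T o p).Reachable o x) (hv : (del T o p).Reachable p v) (hxv : x ≠ v) :
    (sw T o p x v).IsTree := by
  refine ⟨sw_connected hT hx hv hxv, ?_⟩
  refine IsAcyclic.sup_edge_of_not_reachable ?_ (hT.isAcyclic.anti (del_le ..))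
  intro h'
  exact not_reach hT h (hx.trans (h'.trans hv.symm))

lemma lip {T : SimpleGraph V} {f : V → ℕ}
    (hf : ∀ a b, T.Adj a b → f b ≤ f a + 1) {a b : V} (h : T.Reachable a b) : f b ≤ f a + T.dist a b := by
  obtain ⟨w, hw⟩ := h.exists_walk_length_eq_dist
  rw [← hw]
  clear hw h
  induction w with
  | nil => simp
  | cons h w ih => have := hf _ _ h; simp only [Walk.length_cons]; omega

lemma adj_dist {T : SimpleGraph V} (hc : T.Connected) (r : V) {a b : V} (h : T.Adj a b) :
    T.dist r b ≤ T.dist r a + 1 := by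
  have := hc.dist_triangle (u := r) (v := a) (w := b)
  rw [dist_eq_one_iff_adj.2 h] at this; exact this

lemma reach_or {T : SimpleGraph V} (hT : T.Connected) (o p u : V) :
    (del T o p).Reachable o u ∨ (del T o p).Reachable p u := by
  obtain ⟨w⟩ := hT u o
  induction w with
  | nil => exact Or.inl (Reachable.refl _)
  | @cons u w' o h _ ih =>
    by_cases h1 : u = o ∧ w' = p
    · rw [h1.1]; exact Or.inl (Reachable.refl _)
    by_cases h2 : u = p ∧ w' = o
    · rw [h2.1]; exact Or.inr (Reachable.refl _)
    have : (del T o p).Reachable w' u := (Adj.reachable (⟨h, h1, h2⟩ : (del T o p).Adj u w')).symm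
    exact ih.imp (fun h => h.trans this) (fun h => h.trans this)

lemma dist_cross {T : SimpleGraph V} (hT : T.IsTree) {o p x v : V} (h : T.Adj o p)
    (hx : (del T o p).Reachable o x) (hv : (del T o p).Reachable p v) (hxv : x ≠ v) {a : V}
    (ha : (del T o p).Reachable o a) :
    (∀ b, (del T o p).Reachable o b → T.dist a b ≤ (sw T o p x v).dist a b) ∧ 
    (∀ b, (del T o p).Reachable p b → T.dist a x + 1 + T.dist v b ≤ (sw T o p x v).dist a b) := by
  classical
  have hc := sw_connected hT hx hv hxv
  let f : V → ℕ := fun u => if (del T o p).Reachable o u then T.dist a u else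
    T.dist a x + 1 + T.dist v u
  have hB : ∀ b, (del T o p).Reachable p b → ¬ (del T o p).Reachable o b := fun b hb hb' =>
    not_reach hT h (hb'.trans hb.symm)
  have hf : ∀ c e, (sw T o p x v).Adj c e → f e ≤ f c + 1 := by
    intro c e hce
    rcases sw_adj.1 hce with h1 | ⟨⟨rfl, rfl⟩ | ⟨rfl, rfl⟩, _⟩
    · have hr : (del T o p).Reachable c e := Adj.reachable h1
      have : (del T o p).Reachable o c ↔ (del T o p).Reachable o e :=
        ⟨fun h => h.trans hr, fun h => h.trans hr.symm⟩
      simp only [f, this]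
      split_ifs
      · exact adj_dist hT.connected _ h1.1
      · have := adj_dist hT.connected v h1.1; omega
    · simp [f, hx, hB _ hv]
    · simp [f, hx, hB _ hv]; omega
  have hfa : f a = 0 := by simp [f, ha]
  constructor
  · intro b hb
    have := lip hf (hc a b)
    simpa [hfa, f, hb] using this
  · intro b hb
    have := lip hf (hc a b)
    simpa [hfa, f, hB _ hb] using this

lemma del_comm (T : SimpleGraph V) (o p : V) : del T o p = del T p o := by
  ext a b; simp only [del]; tauto

lemma sw_comm (T : SimpleGraph V) (o p x v : V) : sw T o p x v = sw T p o v x := by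
  rw [sw, sw, del_comm, edge_comm]

/-- geodesics -/
lemma path_ex {T : SimpleGraph V} {a b : V} (hc : T.Reachable a b) (hab : a ≠ b) :
    ∃ P : Finset V, a ∈ P ∧ b ∈ P ∧ P.card = T.dist a b + 1 ∧
      (∀ u ∈ P, (res T P).Reachable a u) ∧
      (∀ u ∈ P, u ≠ a → u ≠ b → ∃ c ∈ P, ∃ c' ∈ P, c ≠ c' ∧ T.Adj u c ∧ T.Adj u c') ∧
      (∃ c ∈ P, T.Adj a c) ∧ (∃ c ∈ P, T.Adj b c) ∧
      (∀ u ∈ P, u ≠ b → ∃ q, T.Adj u q ∧ (del T u q).Reachable u a ∧ (del T u q).Reachable q b) := by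
  classical
  obtain ⟨w, hw, hl⟩ := hc.exists_path_of_dist
  have hinj := hw.getVert_injOn
  have hinj' : ∀ i j, i ≤ w.length → j ≤ w.length → w.getVert i = w.getVert j → i = j :=
    fun i j hi hj h => hinj hi hj h
  have hpos : 0 < w.length := by rw [hl]; exact hc.pos_dist_of_ne hab
  have hadj : ∀ i, i < w.length → T.Adj (w.getVert i) (w.getVert (i+1)) :=
    fun i hi => w.adj_getVert_succ hi
  set P : Finset V := (Finset.range (w.length + 1)).image w.getVert with hP
  have hmem : ∀ i, i ≤ w.length → w.getVert i ∈ P := fun i hi =>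
    Finset.mem_image_of_mem _ (Finset.mem_range.2 (by omega))
  have hex : ∀ u ∈ P, ∃ i, i ≤ w.length ∧ w.getVert i = u := by
    intro u hu
    obtain ⟨i, hi, rfl⟩ := Finset.mem_image.1 hu
    exact ⟨i, by have := Finset.mem_range.1 hi; omega, rfl⟩
  have h0 : w.getVert 0 = a := w.getVert_zero
  have hL : w.getVert w.length = b := w.getVert_length
  refine ⟨P, h0 ▸ hmem 0 (by omega), hL ▸ hmem _ le_rfl, ?_, ?_, ?_, ?_, ?_, ?_⟩
  · rw [hP, Finset.card_image_of_injOn, Finset.card_range, hl]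
    intro i hi j hj hij
    simp only [Finset.coe_range, Set.mem_Iio] at hi hj
    exact hinj' i j (by omega) (by omega) hij
  · intro u hu
    obtain ⟨i, hi, rfl⟩ := hex u hu
    clear hu
    induction i with
    | zero => rw [h0]
    | succ i ih =>
      exact (ih (by omega)).trans (Adj.reachable ⟨hadj i hi, hmem _ (by omega), hmem _ hi⟩)
  · intro u hu hua hub
    obtain ⟨i, hi, rfl⟩ := hex u hu
    have hi0 : i ≠ 0 := by rintro rfl; exact hua h0
    have hiL : i ≠ w.length := by rintro rfl; exact hub hL
    refine ⟨w.getVert (i-1), hmem _ (by omega), w.getVert (i+1), hmem _ (by omega), ?_, ?_, ?_⟩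
    · intro h; have := hinj' _ _ (by omega) (by omega) h; omega
    · have := hadj (i-1) (by omega)
      rw [Nat.sub_add_cancel (by omega)] at this; exact this.symm
    · exact hadj i (by omega)
  · refine ⟨w.getVert 1, hmem _ hpos, ?_⟩
    have := hadj 0 hpos
    simpa using this
  · refine ⟨w.getVert (w.length - 1), hmem _ (by omega), ?_⟩
    have := hadj (w.length-1) (by omega)
    rw [Nat.sub_add_cancel (by omega), hL] at this; exact this.symm
  · intro u hu hub
    obtain ⟨i, hi, rfl⟩ := hex u hu
    have hiL : i ≠ w.length := by rintro rfl; exact hub hL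
    refine ⟨w.getVert (i+1), hadj i (by omega), ?_, ?_⟩
    · have : ∀ j, j ≤ i → (del T (w.getVert i) (w.getVert (i+1))).Reachable (w.getVert j) a := by
        intro j
        induction j with
        | zero => intro _; rw [h0]
        | succ j ih =>
          intro hj
          refine Reachable.trans (Adj.reachable ?_) (ih (by omega))
          refine ⟨(hadj j (by omega)).symm, ?_, ?_⟩
          · rintro ⟨_, h2⟩; have := hinj' _ _ (by omega) (by omega) h2; omega
          · rintro ⟨h1, _⟩; have := hinj' _ _ (by omega) (by omega) h1; omega
      exact this i le_rfl
    · have : ∀ j, i + 1 + j ≤ w.length →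
          (del T (w.getVert i) (w.getVert (i+1))).Reachable (w.getVert (i+1)) (w.getVert (i+1+j)) := by
        intro j
        induction j with
        | zero => intro _; exact Reachable.refl _
        | succ j ih =>
          intro hj
          refine (ih (by omega)).trans (Adj.reachable ?_)
          refine ⟨hadj (i+1+j) (by omega), ?_, ?_⟩
          · rintro ⟨h1, _⟩; have := hinj' _ _ (by omega) (by omega) h1; omega
          · rintro ⟨_, h1⟩; have := hinj' (i+1+j+1) _ (by omega) (by omega) h1; omega
      have := this (w.length - (i+1)) (by omega)
      rwa [Nat.add_sub_cancel' (by omega), hL] at this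

/-- first entrance into `S` -/
lemma boundary {T : SimpleGraph V} (hc : T.Connected) {S : Set V} {u s : V} (hu : u ∉ S) (hs : s ∈ S) :
    ∃ o r, o ∈ S ∧ r ∉ S ∧ T.Adj o r ∧ (res T Sᶜ).Reachable r u := by
  obtain ⟨w⟩ := hc u s
  induction w with
  | nil => exact absurd hs hu
  | @cons u u' s h _ ih =>
    by_cases hu' : u' ∈ S
    · exact ⟨u', u, hu', hu, h.symm, Reachable.refl _⟩
    · obtain ⟨o, r, h1, h2, h3, h4⟩ := ih hu' hs
      exact ⟨o, r, h1, h2, h3, h4.trans (Adj.reachable ⟨h.symm, hu', hu⟩)⟩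

lemma parent_uniq {T : SimpleGraph V} (hT : T.IsTree) {r z a b : V} (ha : T.Adj z a) (hb : T.Adj z b)
    (h1 : T.dist r z = T.dist r a + 1) (h2 : T.dist r z = T.dist r b + 1) : a = b := by
  obtain ⟨p, hp⟩ := hT.connected.exists_walk_length_eq_dist r a
  obtain ⟨q, hq⟩ := hT.connected.exists_walk_length_eq_dist r b
  have hp' : (p.concat ha.symm).IsPath := Walk.isPath_of_length_eq_dist _ (by simp [hp, h1])
  have hq' : (q.concat hb.symm).IsPath := Walk.isPath_of_length_eq_dist _ (by simp [hq, h2])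
  have := (hT.existsUnique_path r z).unique hp' hq'
  exact (Walk.concat_inj this).1

section fin
variable [Fintype V]

open Classical in
/-- the set of leaves -/
noncomputable def lv (T : SimpleGraph V) : Finset V :=
  Finset.univ.filter (fun u => (T.neighborSet u).ncard = 1)

lemma mem_lv {T : SimpleGraph V} {u : V} : u ∈ lv T ↔ (T.neighborSet u).ncard = 1 := by
  simp [lv]

lemma mem_lv' {T : SimpleGraph V} {u : V} :
    u ∈ lv T ↔ ∃ c, T.Adj u c ∧ ∀ c', T.Adj u c' → c' = c := by
  rw [mem_lv, Set.ncard_eq_one]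
  constructor
  · rintro ⟨c, hc⟩
    refine ⟨c, ?_, ?_⟩
    · have : c ∈ T.neighborSet u := by rw [hc]; rfl
      exact this
    · intro c' h
      have : c' ∈ T.neighborSet u := h
      rw [hc] at this; exact this
  · rintro ⟨c, h1, h2⟩
    exact ⟨c, Set.ext fun c' => ⟨fun h => h2 _ h, fun h => by cases h; exact h1⟩⟩

lemma leaf_uniq {T : SimpleGraph V} {u a b : V} (h : u ∈ lv T) (ha : T.Adj u a) (hb : T.Adj u b) :
    a = b := by
  obtain ⟨c, _, h2⟩ := mem_lv'.1 h
  rw [h2 a ha, h2 b hb]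

lemma deg3 {T : SimpleGraph V} {u a b c : V} (ha : T.Adj u a) (hb : T.Adj u b) (hc : T.Adj u c)
    (h1 : a ≠ b) (h2 : a ≠ c) (h3 : b ≠ c) : 3 ≤ (T.neighborSet u).ncard := by
  have hs : ({a, b, c} : Set V) ⊆ T.neighborSet u := by
    rintro y (rfl | rfl | rfl)
    exacts [ha, hb, hc]
  have := Set.ncard_le_ncard hs (Set.toFinite _)
  rwa [Set.ncard_eq_three.2 ⟨a, b, c, h1, h2, h3, rfl⟩] at this

lemma deg3_two {T : SimpleGraph V} {u : V} (h : 3 ≤ (T.neighborSet u).ncard) (p : V) :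
    ∃ a b, a ≠ b ∧ a ≠ p ∧ b ≠ p ∧ T.Adj u a ∧ T.Adj u b := by
  have h1 : 1 < (T.neighborSet u \ {p}).ncard := by
    have := Set.le_ncard_sdiff {p} (T.neighborSet u) 
    rw [Set.ncard_singleton] at this; omega
  obtain ⟨a, ha, b, hb, hab⟩ := (Set.one_lt_ncard (Set.toFinite _)).1 h1
  exact ⟨a, b, hab, ha.2, hb.2, ha.1, hb.1⟩

lemma not_leaf_deg3 {T : SimpleGraph V} {u : V} (h : 3 ≤ (T.neighborSet u).ncard) : u ∉ lv T := by
  rw [mem_lv]; omega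

lemma leaf_sw {T : SimpleGraph V} (hT : T.IsTree) {o p x v : V} (h : T.Adj o p)
    (hx : (del T o p).Reachable o x) (hv : (del T o p).Reachable p v) 
    (hxl : x ∈ lv T) (ho : 3 ≤ (T.neighborSet o).ncard) {u : V} (hu : u ∈ lv (sw T o p x v)) :
    u ≠ x ∧ (u = p ∨ u ∈ lv T) ∧ (u = v → v = p) ∧ (v = p → u ∈ lv T) := by
  have hxo : x ≠ o := by rintro rfl; exact not_leaf_deg3 ho hxl
  have hB : ∀ b, (del T o p).Reachable p b → ¬ (del T o p).Reachable o b := fun b hb hb' =>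
    not_reach hT h (hb'.trans hb.symm)
  have hxp : x ≠ p := by rintro rfl; exact hB _ (Reachable.refl _) hx
  have hxv : x ≠ v := by rintro rfl; exact hB _ hv hx
  have hvo : v ≠ o := by rintro rfl; exact hB _ hv (Reachable.refl _)
  have hop := h.ne
  have hnew : (sw T o p x v).Adj x v := sw_adj.2 (Or.inr ⟨Or.inl ⟨rfl, rfl⟩, hxv⟩)
  have hux : u ≠ x := by
    rintro rfl
    obtain ⟨c, hc, _⟩ := mem_lv'.1 hxl
    have hc' : (del T o p).Adj u c := ⟨hc, fun h => hxo h.1, fun h => hxp h.1⟩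
    have := leaf_uniq hu hnew (del_le_sw _ _ _ _ _ hc')
    subst this
    exact hB _ hv (hx.trans hc'.reachable)
  have huo : u ≠ o := by
    rintro rfl
    obtain ⟨a, b, hab, ha, hb, haa, hbb⟩ := deg3_two ho p
    exact hab (leaf_uniq hu (sw_adj.2 (Or.inl ⟨haa, fun h => ha h.2, fun h => hop h.1⟩))
      (sw_adj.2 (Or.inl ⟨hbb, fun h => hb h.2, fun h => hop h.1⟩)))
  have huv : u = v → v = p := by
    rintro rfl
    by_contra hne
    obtain ⟨w⟩ := hv.symm
    cases w with
    | nil => exact hne rfl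
    | @cons _ c _ hc _ =>
      have := leaf_uniq hu hnew.symm (del_le_sw _ _ _ _ _ hc)
      subst this
      exact hB _ (hv.trans hc.reachable) hx
  refine ⟨hux, ?_, huv, ?_⟩
  · by_contra! hcon
    have huv' : u ≠ v := fun h => hcon.1 (h.trans (huv h))
    apply hcon.2
    rw [mem_lv'] at hu ⊢
    simp only [sw_adj, huo, hcon.1, hux, huv', false_and, not_false_eq_true, and_true, or_false] at hu
    exact hu
  · rintro rfl
    by_cases hup : u = v
    · subst hup
      rw [mem_lv']
      refine ⟨o, h.symm, ?_⟩
      intro c' hc'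
      by_contra hne
      have hc'' : (del T o u).Adj u c' := ⟨hc', fun h => huo h.1, fun h => hne h.2⟩
      have := leaf_uniq hu hnew.symm (del_le_sw _ _ _ _ _ hc'')
      subst this
      exact hB _ hc''.reachable hx
    · rw [mem_lv'] at hu ⊢
      simp only [sw_adj, huo, hup, hux, false_and, not_false_eq_true, and_true, or_false] at hu
      exact hu

/-- spanning tree of `G` with minimum number of leaves -/
structure MinT (G T : SimpleGraph V) : Prop where
  le : T ≤ G
  tree : T.IsTree
  min : ∀ T' : SimpleGraph V, T' ≤ G → T'.IsTree → (lv T).card ≤ (lv T').card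

lemma exch [DecidableEq V] {G T : SimpleGraph V} (hm : MinT G T) {o p x v : V} (h : T.Adj o p)
    (hx : (del T o p).Reachable o x) (hv : (del T o p).Reachable p v) 
    (hxl : x ∈ lv T) (ho : 3 ≤ (T.neighborSet o).ncard) (hxv : G.Adj x v) :
    MinT G (sw T o p x v) ∧ p ≠ v ∧ v ∉ lv T ∧ p ∉ lv T ∧
      lv (sw T o p x v) = insert p ((lv T).erase x) ∧ (T.neighborSet p).ncard ≤ 2 := by
  have hle : sw T o p x v ≤ G := by
    intro a b hab
    rcases sw_adj.1 hab with h1 | ⟨⟨rfl, rfl⟩ | ⟨rfl, rfl⟩, _⟩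
    · exact hm.le h1.1
    · exact hxv
    · exact hxv.symm
  have htree := sw_isTree hm.tree h hx hv hxv.ne
  have hL := fun u => leaf_sw hm.tree h hx hv hxl ho (u := u)
  have hmin := hm.min _ hle htree
  have hpv : p ≠ v := by
    rintro rfl
    have hs : lv (sw T o p x p) ⊆ (lv T).erase x := fun u hu => 
      Finset.mem_erase.2 ⟨(hL u hu).1, (hL u hu).2.2.2 rfl⟩
    have := Finset.card_le_card hs
    rw [Finset.card_erase_of_mem hxl] at this
    have := Finset.card_pos.2 ⟨x, hxl⟩
    omega
  have hs : lv (sw T o p x v) ⊆ insert p (((lv T).erase x).erase v) := by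
    intro u hu
    obtain ⟨h1, h2, h3, h4⟩ := hL u hu
    rcases h2 with h2 | h2
    · simp [h2]
    · refine Finset.mem_insert_of_mem (Finset.mem_erase.2 ⟨?_, Finset.mem_erase.2 ⟨h1, h2⟩⟩)
      exact fun h => hpv (h3 h).symm
  have hc := Finset.card_le_card hs
  have hpos := Finset.card_pos.2 ⟨x, hxl⟩
  have hce := Finset.card_erase_of_mem hxl
  have hvl : v ∉ lv T := by
    intro hvl
    have h1 := Finset.card_insert_le p (((lv T).erase x).erase v)
    have h2 := Finset.card_erase_of_mem (Finset.mem_erase.2 ⟨hxv.ne', hvl⟩)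
    have h3 := Finset.card_pos.2 ⟨v, Finset.mem_erase.2 ⟨hxv.ne', hvl⟩⟩
    omega
  have hev : ((lv T).erase x).erase v = (lv T).erase x :=
    Finset.erase_eq_of_notMem (fun h => hvl (Finset.mem_of_mem_erase h))
  rw [hev] at hs hc
  have hxp : x ≠ p := by rintro rfl; exact not_reach hm.tree h hx
  have hpl : p ∉ lv T := by
    intro hpl
    rw [Finset.insert_eq_of_mem (Finset.mem_erase.2 ⟨hxp.symm, hpl⟩)] at hc
    omega
  have h1 := Finset.card_insert_le p ((lv T).erase x)
  have heq : lv (sw T o p x v) = insert p ((lv T).erase x) :=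
    Finset.eq_of_subset_of_card_le hs (by omega)
  refine ⟨⟨hle, htree, fun T' h1' h2' => ?_⟩, hpv, hvl, hpl, heq, ?_⟩
  · have := hm.min T' h1' h2'
    rw [heq]; omega
  · have hpl' : p ∈ lv (sw T o p x v) := by rw [heq]; simp
    obtain ⟨c, hc1, hc2⟩ := mem_lv'.1 hpl'
    have : T.neighborSet p ⊆ {o, c} := by
      intro e he
      by_cases heo : e = o
      · left; exact heo
      · right
        exact hc2 e (sw_adj.2 (Or.inl ⟨he, fun h' => h.ne h'.1.symm, fun h' => heo h'.2⟩))
    have h1 := Set.ncard_le_ncard this (Set.toFinite _)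
    have h2 := Set.ncard_insert_le o ({c} : Set V)
    rw [Set.ncard_singleton] at h2
    omega

lemma leaf_side {T : SimpleGraph V} (hT : T.IsTree) {o p : V} (h : T.Adj o p) :
    ∃ z ∈ lv T, (del T o p).Reachable p z := by
  obtain ⟨z, hz, hmax⟩ := Set.exists_max_image {z | (del T o p).Reachable p z} (fun z => T.dist o z)
    (Set.toFinite _) ⟨p, Reachable.refl _⟩
  refine ⟨z, ?_, hz⟩
  have hzo : z ≠ o := by rintro rfl; exact not_reach hT h hz.symm
  have hclose : ∀ c, T.Adj z c → T.dist o z = T.dist o c + 1 := by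
    intro c hc
    rcases hT.dist_eq_dist_add_one_of_adj o hc with h1 | h1
    · exact h1
    · exfalso
      have hco : c ≠ o := by rintro rfl; simp at h1
      have : (del T o p).Reachable p c :=
        Reachable.trans hz (Adj.reachable ⟨hc, fun h => hzo h.1, fun h => hco h.2⟩)
      have := hmax c this
      omega
  rw [mem_lv']
  obtain ⟨w⟩ := hT.connected z o
  cases w with
  | nil => exact absurd rfl hzo
  | @cons _ c _ hc _ =>
    exact ⟨c, hc, fun c' hc' => parent_uniq hT hc' hc (hclose _ hc') (hclose _ hc)⟩

lemma leaf_indep {G T : SimpleGraph V} (hm : MinT G T) (h3 : 3 ≤ (lv T).card) :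
    ∀ a ∈ lv T, ∀ b ∈ lv T, ¬ G.Adj a b := by
  classical
  intro a ha b hb hab
  obtain ⟨P, haP, hbP, -, -, hint, ⟨ca, hca, hca'⟩, ⟨cb, hcb, hcb'⟩, hnext⟩ :=
    path_ex (hm.tree.connected a b) hab.ne
  obtain ⟨c, hc, hcne⟩ : ∃ c ∈ lv T, c ≠ a ∧ c ≠ b := by
    by_contra! hcon
    have : lv T ⊆ {a, b} := fun c hc => by
      by_cases h : c = a
      · simp [h]
      · simp [hcon c hc h]
    have := (Finset.card_le_card this).trans Finset.card_le_two
    omega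
  have hcP : c ∉ P := by
    intro hcP
    obtain ⟨e, _, e', _, hne, h1, h2⟩ := hint c hcP hcne.1 hcne.2
    exact hne (leaf_uniq hc h1 h2)
  obtain ⟨o, r, hoP, hrP, hor, -⟩ := boundary hm.tree.connected (S := (P : Set V)) hcP haP
  have hoa : o ≠ a := by rintro rfl; exact hrP (leaf_uniq ha hca' hor ▸ hca)
  have hob : o ≠ b := by rintro rfl; exact hrP (leaf_uniq hb hcb' hor ▸ hcb)
  obtain ⟨e, he, e', he', hne, h1, h2⟩ := hint o hoP hoa hob
  have ho : 3 ≤ (T.neighborSet o).ncard :=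
    deg3 h1 h2 hor hne (fun h => hrP (h ▸ he)) (fun h => hrP (h ▸ he'))
  obtain ⟨q, hq, hqa, hqb⟩ := hnext o hoP hob
  exact (exch hm hq hqa hqb ha ho hab).2.2.1 hb

lemma exch_indep [DecidableEq V] {G T : SimpleGraph V} (hm : MinT G T) (h3 : 3 ≤ (lv T).card)
    {o p x v : V} (h : T.Adj o p)
    (hx : (del T o p).Reachable o x) (hv : (del T o p).Reachable p v) 
    (hxl : x ∈ lv T) (ho : 3 ≤ (T.neighborSet o).ncard) (hxv : G.Adj x v) :
    ¬ G.Adj x p ∧ ∀ a ∈ lv T, ¬ G.Adj a p := by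
  have hxp : ¬ G.Adj x p := fun hxp => (exch hm h hx (Reachable.refl _) hxl ho hxp).2.1 rfl
  refine ⟨hxp, ?_⟩
  intro a ha hap
  obtain ⟨h1, h2, h4, h5, h6, h7⟩ := exch hm h hx hv hxl ho hxv
  by_cases hax : a = x
  · subst hax; exact hxp hap
  · have hcard : 3 ≤ (lv (sw T o p x v)).card := h3.trans (hm.min _ h1.le h1.tree)
    exact leaf_indep h1 hcard a (by rw [h6]; simp [hax, ha]) p (by rw [h6]; simp) hap

lemma del_dist_le {T : SimpleGraph V} (hT : T.IsTree) {o p z : V} (h : T.Adj o p)  :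
    (del T o p).dist p z ≤ T.dist p z := by
  classical
  let f : V → ℕ := fun u => (del T o p).dist p u
  have hf : ∀ c e, T.Adj c e → f e ≤ f c + 1 := by
    intro c e hce
    by_cases h1 : c = o ∧ e = p
    · obtain ⟨rfl, rfl⟩ := h1; simp [f]
    by_cases h2 : c = p ∧ e = o
    · obtain ⟨rfl, rfl⟩ := h2
      simp [f, dist_eq_zero_of_not_reachable fun h' => not_reach hT h h'.symm]
    have h3 : (del T o p).Adj c e := ⟨hce, h1, h2⟩
    have := h3.diff_dist_adj (u := p)
    simp only [f]; omega
  have := lip hf (hT.connected p z)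
  simpa [f] using this

lemma core {G T : SimpleGraph V} {d : ℕ} (hd : 4 ≤ d)
    (hα : ∀ I : Finset V, (∀ u ∈ I, ∀ v ∈ I, ¬G.Adj u v) → I.card ≤ 5)
    (hδ : ∀ I : Finset V, (∀ u ∈ I, ∀ v ∈ I, ¬G.Adj u v) → I.card = 4 →
      2 * (d - 2) < ({v : V | ∃ u ∈ I, G.Adj u v}).ncard)
    (hm : MinT G T) (h3 : 3 ≤ (lv T).card) {x y : V} (hx : x ∈ lv T) (hy : y ∈ lv T) (hxy : x ≠ y)
    (hs : T.dist x y < d) {P : Finset V} (hxP : x ∈ P) (hyP : y ∈ P) (hPc : P.card = T.dist x y + 1)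
    (hPr : ∀ u ∈ P, (res T P).Reachable x u)
    (hPi : ∀ u ∈ P, u ≠ x → u ≠ y → ∃ c ∈ P, ∃ c' ∈ P, c ≠ c' ∧ T.Adj u c ∧ T.Adj u c')
    (hPx : ∃ c ∈ P, T.Adj x c) (hPy : ∃ c ∈ P, T.Adj y c)
    {o p v : V} (hoP : o ∈ P) (hpP : p ∉ P) (hop : T.Adj o p)
    (ho : 3 ≤ (T.neighborSet o).ncard) (hxv : G.Adj x v)
    (hpv : (res T (P : Set V)ᶜ).Reachable p v) {z : V} (hz : z ∈ lv T)
    (hpz : (del T o p).Reachable p z) : T.dist x y < T.dist p z := by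
  classical
  have hT := hm.tree
  set R := del T o p with hR
  have hPR : ∀ u ∈ P, R.Reachable o u := by
    have : res T P ≤ R := res_le_del (fun h => hpP h.2)
    exact fun u hu => ((hPr o hoP).symm.trans (hPr u hu)).mono this
  have hpvR : R.Reachable p v := hpv.mono (res_le_del (S := (P : Set V)ᶜ) (fun h => h.1 hoP))
  have hB : ∀ b, R.Reachable p b → ¬ R.Reachable o b := fun b hb hb' =>
    not_reach hT hop (hb'.trans hb.symm)
  obtain ⟨hm', hpnv, hvl, hpl, hL', hpdeg⟩ := exch hm hop (hPR x hxP) hpvR hx ho hxv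
  have hLp := (exch_indep hm h3 hop (hPR x hxP) hpvR hx ho hxv).2
  have hLL := leaf_indep hm h3
  set T' := sw T o p x v with hT'
  have h3' : 3 ≤ (lv T').card := h3.trans (hm.min _ hm'.le hm'.tree)
  have hpl' : p ∈ lv T' := by rw [hL']; simp
  have hpz' : p ≠ z := by rintro rfl; exact hpl hz
  obtain ⟨Q, hpQ, hzQ, hQc, hQr, hQi, ⟨cp, hcp, hcp'⟩, ⟨cz, hcz, hcz'⟩, -⟩ := path_ex hpz hpz'
  have hQR : ∀ u ∈ Q, R.Reachable p u := fun u hu => (hQr u hu).mono (res_le _ _)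
  have hoQ : o ∉ Q := fun h => hB _ (hQR o h) (Reachable.refl _)
  have hRT : R ≤ T := del_le _ _ _
  set S : Finset V := P ∪ Q with hS
  have hPS : (P : Set V) ⊆ S := by intro u hu; simp [hS, Finset.mem_coe.1 hu]
  have hQS : (Q : Set V) ⊆ S := by intro u hu; simp [hS, Finset.mem_coe.1 hu]
  have hSo : ∀ u ∈ S, (res T S).Reachable o u := by
    intro u hu
    rcases Finset.mem_union.1 hu with hu | hu
    · exact ((hPr o hoP).symm.trans (hPr u hu)).mono (res_mono le_rfl hPS)
    · refine Reachable.trans (Adj.reachable ⟨hop, hPS hoP, hQS hpQ⟩) ?_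
      exact (hQr u hu).mono (res_mono hRT hQS)
  -- degrees of exits of `S`
  have hdeg : ∀ e r, e ∈ S → r ∉ S → T.Adj e r →
      3 ≤ (T.neighborSet e).ncard ∧ 3 ≤ (T'.neighborSet e).ncard := by
    intro e r he hr her
    have hrP : r ∉ P := fun h => hr (hPS h)
    have hrQ : r ∉ Q := fun h => hr (hQS h)
    rcases Finset.mem_union.1 he with he | he
    · have hex : e ≠ x := by
        rintro rfl
        obtain ⟨c, hc, hc'⟩ := hPx
        exact hrP (leaf_uniq hx hc' her ▸ hc)
      have hey : e ≠ y := by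
        rintro rfl
        obtain ⟨c, hc, hc'⟩ := hPy
        exact hrP (leaf_uniq hy hc' her ▸ hc)
      obtain ⟨c, hc, c', hc', hne, h1, h2⟩ := hPi e he hex hey
      have key : ∀ f, f ≠ p → T.Adj e f → T'.Adj e f := fun f hf h =>
        sw_adj.2 (Or.inl ⟨h, fun h => hf h.2, fun h => hpP (h.1 ▸ he)⟩)
      have n1 : c ≠ r := fun h => hrP (h ▸ hc)
      have n2 : c' ≠ r := fun h => hrP (h ▸ hc')
      refine ⟨deg3 h1 h2 her hne n1 n2, deg3 (key _ ?_ h1) (key _ ?_ h2) (key _ ?_ her) hne n1 n2⟩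
      · rintro rfl; exact hpP hc
      · rintro rfl; exact hpP hc'
      · rintro rfl; exact hrQ hpQ
    · have hez : e ≠ z := by
        rintro rfl
        exact hrQ (leaf_uniq hz (hRT hcz') her ▸ hcz)
      have hep : e ≠ p := by
        rintro rfl
        have := deg3 hop.symm (hRT hcp') her (fun h => hoQ (h ▸ hcp)) (fun h => hrP (h ▸ hoP))
          (fun h => hrQ (h ▸ hcp))
        omega
      obtain ⟨c, hc, c', hc', hne, h1, h2⟩ := hQi e he hep hez
      have key : ∀ f, T.Adj e f → T'.Adj e f := fun f h =>
        sw_adj.2 (Or.inl ⟨h, fun h => hoQ (h.1 ▸ he), fun h => hep h.1⟩)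
      have n1 : c ≠ r := fun h => hrQ (h ▸ hc)
      have n2 : c' ≠ r := fun h => hrQ (h ▸ hc')
      exact ⟨deg3 (hRT h1) (hRT h2) her hne n1 n2,
        deg3 (key _ (hRT h1)) (key _ (hRT h2)) (key _ her) hne n1 n2⟩
  have hadj' : ∀ e r, e ∈ S → r ∉ S → T.Adj e r → T'.Adj e r := fun e r he hr her =>
    sw_adj.2 (Or.inl ⟨her, fun h => hr (h.2 ▸ hQS hpQ), fun h => hr (h.2 ▸ hPS hoP)⟩)
  have hSe : ∀ e r, e ∈ S → r ∉ S → ∀ u ∈ S, (del T e r).Reachable e u := fun e r he hr u hu =>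
    ((hSo e he).symm.trans (hSo u hu)).mono (res_le_del (fun h => hr h.2))
  -- the sixth independent vertex
  have hfin : ∀ e r, e ∈ S → r ∉ S → T.Adj e r → (∀ a ∈ lv T, ¬ G.Adj a r) → ¬ G.Adj p r →
      r ∉ lv T → False := by
    intro e r he hr her h1 h2 h4
    obtain ⟨w, hw, hwr⟩ := leaf_side hT her
    have hwS : w ∉ S := fun h => not_reach hT her ((hSe e r he hr w h).trans hwr.symm)
    have hzP : z ∉ P := fun h => hB _ hpz (hPR z h)
    have h4c : ({x, y, z, w} : Finset V).card = 4 := by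
      have a1 : x ≠ z := fun h => hzP (h ▸ hxP)
      have a2 : y ≠ z := fun h => hzP (h ▸ hyP)
      have a3 : x ≠ w := fun h => hwS (h ▸ hPS hxP)
      have a4 : y ≠ w := fun h => hwS (h ▸ hPS hyP)
      have a5 : z ≠ w := fun h => hwS (h ▸ hQS hzQ)
      rw [Finset.card_insert_of_notMem (by simp [*]), Finset.card_insert_of_notMem (by simp [*]),
        Finset.card_insert_of_notMem (by simp [*]), Finset.card_singleton]
    have hsub : ({x, y, z, w} : Finset V) ⊆ lv T := by
      intro u hu
      simp only [Finset.mem_insert, Finset.mem_singleton] at hu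
      rcases hu with rfl | rfl | rfl | rfl <;> assumption
    have hcard := Finset.card_le_card hsub
    have hrp : r ≠ p := fun h => hr (h ▸ hQS hpQ)
    have := hα (insert r (insert p (lv T))) (by
      intro a ha b hb hab
      simp only [Finset.mem_insert] at ha hb
      rcases ha with rfl | rfl | ha <;> rcases hb with rfl | rfl | hb
      · exact hab.ne rfl
      · exact h2 hab.symm
      · exact h1 _ hb hab.symm
      · exact h2 hab
      · exact hab.ne rfl
      · exact hLp _ hb hab.symm
      · exact h1 _ ha hab
      · exact hLp _ ha hab
      · exact hLL _ ha _ hb hab)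
    rw [Finset.card_insert_of_notMem (by simp [hrp, h4]), Finset.card_insert_of_notMem hpl] at this
    omega
  -- a leaf of `T` inside `S` has no neighbour outside
  have hoffL : ∀ t u e r, t ∈ lv T → t ∈ S → G.Adj t u → e ∈ S → r ∉ S → T.Adj e r →
      (res T (S : Set V)ᶜ).Reachable r u → (del T' e r).Reachable e p → False := by
    intro t u e r ht htS htu he hr her hru hep
    have hde := hdeg e r he hr her
    have hru' : (del T e r).Reachable r u := hru.mono (res_le_del (S := (S : Set V)ᶜ) (fun h => h.1 he))
    have h1 := (exch_indep hm h3 her (hSe e r he hr t htS) hru' ht hde.1 htu).2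
    have h2 := (exch hm her (hSe e r he hr t htS) hru' ht hde.1 htu).2.2.2.1
    refine hfin e r he hr her h1 ?_ h2
    intro hpr
    exact (exch hm' (hadj' e r he hr her) hep (Reachable.refl _) hpl' hde.2 hpr).2.1 rfl
  have hQT' : ∀ u ∈ Q, (res T' Q).Reachable p u := fun u hu =>
    (hQr u hu).mono (res_mono (del_le_sw _ _ _ _ _) subset_rfl)
  have hvS : v ∈ S := by
    by_contra hvS
    obtain ⟨e, r, he, hr, her, hrv⟩ := boundary hT.connected (S := (S : Set V)) hvS (hPS hxP)
    have heQ : e ∈ Q := by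
      rcases Finset.mem_union.1 he with heP | heQ
      · exfalso
        have hrB : R.Reachable p r :=
          hpvR.trans (hrv.mono (res_le_del (S := (S : Set V)ᶜ) (fun h => h.1 (hPS hoP)))).symm
        have : R.Adj e r := ⟨her, fun h => hr (h.2 ▸ hQS hpQ), fun h => hr (h.2 ▸ hPS hoP)⟩
        exact hB _ hrB ((hPR e heP).trans this.reachable)
      · exact heQ
    refine hoffL x v e r hx (hPS hxP) hxv he hr her hrv ?_
    exact ((hQT' e heQ).mono (res_le_del (fun h => hr (hQS h.2)))).symm
  have hvQ : v ∈ Q := by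
    rcases Finset.mem_union.1 hvS with h | h
    · exact absurd (hPR v h) (hB _ hpvR)
    · exact h
  have hST' : ∀ u ∈ S, (res T' S).Reachable p u := by
    intro u hu
    rcases Finset.mem_union.1 hu with hu | hu
    · refine ((hQT' v hvQ).mono (res_mono le_rfl hQS)).trans ?_
      refine Reachable.trans (Adj.reachable
        (⟨sw_adj.2 (Or.inr ⟨Or.inr ⟨rfl, rfl⟩, hxv.ne'⟩), hvS, hPS hxP⟩ : (res T' S).Adj v x)) ?_
      refine (hPr u hu).mono ?_
      intro a b hab
      refine ⟨sw_adj.2 (Or.inl ⟨hab.1, ?_, ?_⟩), hPS hab.2.1, hPS hab.2.2⟩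
      · intro h; exact hpP (h.2 ▸ hab.2.2)
      · intro h; exact hpP (h.1 ▸ hab.2.1)
    · exact (hQT' u hu).mono (res_mono le_rfl hQS)
  have hepS : ∀ e r, e ∈ S → r ∉ S → (del T' e r).Reachable e p := fun e r he hr =>
    ((hST' e he).mono (res_le_del (fun h => hr h.2))).symm
  have hxS : x ∈ S := hPS hxP
  have hyS : y ∈ S := hPS hyP
  have hzS : z ∈ S := hQS hzQ
  have hpS : p ∈ S := hQS hpQ
  have hclosed : ∀ t u, (t = x ∨ t = y ∨ t = z ∨ t = p) → G.Adj t u → u ∈ S := by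
    intro t u ht htu
    by_contra huS
    obtain ⟨e, r, he, hr, her, hru⟩ := boundary hT.connected (S := (S : Set V)) huS hxS
    have hep := hepS e r he hr
    rcases ht with rfl | rfl | rfl | rfl
    · exact hoffL t u e r hx hxS htu he hr her hru hep
    · exact hoffL t u e r hy hyS htu he hr her hru hep
    · exact hoffL t u e r hz hzS htu he hr her hru hep
    · have hde := hdeg e r he hr her
      have hru' : (del T' e r).Reachable r u := by
        refine hru.mono ?_
        intro a b hab
        refine ⟨sw_adj.2 (Or.inl ⟨hab.1, ?_, ?_⟩), ?_, ?_⟩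
        · intro h; exact hab.2.2 (h.2 ▸ hpS)
        · intro h; exact hab.2.1 (h.1 ▸ hpS)
        · intro h; exact hab.2.1 (h.1 ▸ he)
        · intro h; exact hab.2.2 (h.2 ▸ he)
      have h1 := (exch_indep hm' h3' (hadj' e r he hr her) hep hru' hpl' hde.2 htu).2
      have h2 := (exch hm' (hadj' e r he hr her) hep hru' hpl' hde.2 htu).2.2.2.1
      refine hfin e r he hr her ?_ (h1 t hpl') ?_
      · intro a ha har
        by_cases hax : a = x
        · subst hax
          exact (exch hm her (hSe e r he hr a hxS) (Reachable.refl _) hx hde.1 har).2.1 rfl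
        · exact h1 a (by rw [hL']; simp [hax, ha]) har
      · intro hrl
        apply h2
        rw [hL']
        have : r ≠ x := fun h => hr (h ▸ hxS)
        simp [this, hrl]
  have hzP : z ∉ P := fun h => hB _ hpz (hPR z h)
  have h4c : ({x, y, z, p} : Finset V).card = 4 := by
    have a1 : x ≠ z := fun h => hzP (h ▸ hxP)
    have a2 : y ≠ z := fun h => hzP (h ▸ hyP)
    have a3 : x ≠ p := fun h => hpP (h ▸ hxP)
    have a4 : y ≠ p := fun h => hpP (h ▸ hyP)
    have a5 : z ≠ p := hpz'.symm
    rw [Finset.card_insert_of_notMem (by simp [*]), Finset.card_insert_of_notMem (by simp [*]),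
      Finset.card_insert_of_notMem (by simp [*]), Finset.card_singleton]
  have hind : ∀ u ∈ ({x, y, z, p} : Finset V), ∀ w ∈ ({x, y, z, p} : Finset V), ¬ G.Adj u w := by
    have hor : ∀ u ∈ ({x, y, z, p} : Finset V), u ∈ lv T ∨ u = p := by
      intro u hu
      simp only [Finset.mem_insert, Finset.mem_singleton] at hu
      rcases hu with rfl | rfl | rfl | rfl
      exacts [Or.inl hx, Or.inl hy, Or.inl hz, Or.inr rfl]
    intro u hu w hw huw
    rcases hor u hu with h1 | rfl <;> rcases hor w hw with h2 | rfl
    · exact hLL _ h1 _ h2 huw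
    · exact hLp _ h1 huw
    · exact hLp _ h2 huw.symm
    · exact huw.ne rfl
  have hN := hδ _ hind h4c
  have hsub4 : ({x, y, z, p} : Finset V) ⊆ S := by
    intro u hu
    simp only [Finset.mem_insert, Finset.mem_singleton] at hu
    rcases hu with rfl | rfl | rfl | rfl <;> assumption
  have hNs : {v : V | ∃ u ∈ ({x, y, z, p} : Finset V), G.Adj u v} ⊆
      ((S \ {x, y, z, p} : Finset V) : Set V) := by
    rintro w ⟨u, hu, huw⟩
    rw [Finset.mem_coe, Finset.mem_sdiff]
    refine ⟨hclosed u w (by simpa using hu) huw, fun hw => hind u hu w hw huw⟩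
  have hNc := Set.ncard_le_ncard hNs (Set.toFinite _)
  rw [Set.ncard_coe_finset, Finset.card_sdiff_of_subset hsub4, h4c] at hNc
  have hSc : S.card ≤ P.card + Q.card := Finset.card_union_le _ _
  have : R.dist p z ≤ T.dist p z := del_dist_le hT hop
  rw [hPc, hQc] at hSc
  omega

open Classical in
/-- the potential -/
noncomputable def Phi (d : ℕ) (T : SimpleGraph V) : ℕ :=
  ∑ q ∈ (lv T).offDiag, (Fintype.card V ^ 2 + 1) ^ (d - T.dist q.1 q.2)

lemma improve {G T : SimpleGraph V} {d : ℕ} (hd : 4 ≤ d)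
    (hα : ∀ I : Finset V, (∀ u ∈ I, ∀ v ∈ I, ¬G.Adj u v) → I.card ≤ 5)
    (hδ : ∀ I : Finset V, (∀ u ∈ I, ∀ v ∈ I, ¬G.Adj u v) → I.card = 4 →
      2 * (d - 2) < ({v : V | ∃ u ∈ I, G.Adj u v}).ncard)
    (hm : MinT G T) (h3 : 3 ≤ (lv T).card) {x y : V} (hx : x ∈ lv T) (hy : y ∈ lv T) (hxy : x ≠ y)
    (hs : T.dist x y < d) {P : Finset V} (hxP : x ∈ P) (hyP : y ∈ P) (hPc : P.card = T.dist x y + 1)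
    (hPr : ∀ u ∈ P, (res T P).Reachable x u)
    (hPi : ∀ u ∈ P, u ≠ x → u ≠ y → ∃ c ∈ P, ∃ c' ∈ P, c ≠ c' ∧ T.Adj u c ∧ T.Adj u c')
    (hPx : ∃ c ∈ P, T.Adj x c) (hPy : ∃ c ∈ P, T.Adj y c)
    (hmins : ∀ a ∈ lv T, ∀ b ∈ lv T, a ≠ b → T.dist x y ≤ T.dist a b)
    {v : V} (hvP : v ∉ P) (hxv : G.Adj x v) : ∃ T', MinT G T' ∧ Phi d T' < Phi d T := by
  classical
  have hT := hm.tree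
  obtain ⟨o, p, hoP, hpP, hop, hpv⟩ := boundary hT.connected (S := (P : Set V)) hvP hxP
  have hoP : o ∈ P := hoP
  have hpP : p ∉ P := hpP
  have hox : o ≠ x := by
    rintro rfl
    obtain ⟨c, hc, hc'⟩ := hPx
    exact hpP (leaf_uniq hx hc' hop ▸ hc)
  have hoy : o ≠ y := by
    rintro rfl
    obtain ⟨c, hc, hc'⟩ := hPy
    exact hpP (leaf_uniq hy hc' hop ▸ hc)
  have ho : 3 ≤ (T.neighborSet o).ncard := by
    obtain ⟨c, hc, c', hc', hne, h1, h2⟩ := hPi o hoP hox hoy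
    exact deg3 h1 h2 hop hne (fun h => hpP (h ▸ hc)) (fun h => hpP (h ▸ hc'))
  have hle : res T P ≤ del T o p := res_le_del (fun h => hpP h.2)
  have hoxR : (del T o p).Reachable o x := (hPr o hoP).symm.mono hle
  have hpvR : (del T o p).Reachable p v :=
    hpv.mono (res_le_del (S := (P : Set V)ᶜ) (fun h => h.1 hoP))
  obtain ⟨hm', hpnv, hvl, hpl, hL', hpdeg⟩ := exch hm hop hoxR hpvR hx ho hxv
  have hcore : ∀ z ∈ lv T, (del T o p).Reachable p z → T.dist x y < T.dist p z := fun z hz hpz =>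
    core hd hα hδ hm h3 hx hy hxy hs hxP hyP hPc hPr hPi hPx hPy hoP hpP hop ho hxv hpv hz hpz
  have hcross := fun a ha => dist_cross hT hop hoxR hpvR hxv.ne (a := a) ha
  have hcross' : ∀ a b, (del T o p).Reachable p a → (del T o p).Reachable p b →
      T.dist a b ≤ (sw T o p x v).dist a b := by
    intro a b ha hb
    rw [del_comm] at ha hb
    have := (dist_cross hT hop.symm (by rw [del_comm]; exact hpvR) (by rw [del_comm]; exact hoxR)
      hxv.ne.symm ha).1 b hb
    rwa [← sw_comm] at this
  set T' := sw T o p x v with hT'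
  have hnp : ¬ (del T o p).Reachable o p := not_reach hT hop
  have hmem : ∀ a ∈ lv T', a ≠ p → a ∈ (lv T).erase x := by
    intro a ha hap
    rw [hL', Finset.mem_insert] at ha
    exact ha.resolve_left hap
  have H : ∀ a ∈ lv T', ∀ b ∈ lv T', a ≠ b →
      (a ∈ (lv T).erase x ∧ b ∈ (lv T).erase x ∧ T.dist a b ≤ T'.dist a b) ∨
        T.dist x y < T'.dist a b := by
    intro a ha b hb hab
    have key : ∀ a ∈ lv T', ∀ b, (del T o p).Reachable o a → (del T o p).Reachable p b →
        T.dist x y < T'.dist a b := by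
      intro a ha b hoa hpb
      have h1 := (hcross a hoa).2 b hpb
      have h2 := Finset.mem_erase.1 (hmem a ha (fun h => hnp (h ▸ hoa)))
      have h4 := hmins a h2.2 x hx h2.1
      omega
    rcases reach_or hT.connected o p a with hoa | hpa <;>
      rcases reach_or hT.connected o p b with hob | hpb
    · exact Or.inl ⟨hmem a ha (fun h => hnp (h ▸ hoa)), hmem b hb (fun h => hnp (h ▸ hob)),
        (hcross a hoa).1 b hob⟩
    · exact Or.inr (key a ha b hoa hpb)
    · right; rw [SimpleGraph.dist_comm (u := a)]; exact key b hb a hob hpa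
    · have h1 := hcross' a b hpa hpb
      by_cases hap : a = p
      · right
        have h2 := Finset.mem_erase.1 (hmem b hb (fun h => hab (hap.trans h.symm)))
        have h4 := hcore b h2.2 hpb
        rw [← hap] at h4
        omega
      · by_cases hbp : b = p
        · right
          have h2 := Finset.mem_erase.1 (hmem a ha hap)
          have h4 := hcore a h2.2 hpa
          rw [← hbp, SimpleGraph.dist_comm (u := b)] at h4
          omega
        · exact Or.inl ⟨hmem a ha hap, hmem b hb hbp, h1⟩
  refine ⟨T', hm', ?_⟩
  unfold Phi
  set n := Fintype.card V with hn
  set K := n ^ 2 + 1 with hK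
  set s := T.dist x y with hs'
  have hKpos : 0 < K := by omega
  set E := ((lv T).erase x).offDiag with hE
  have hbound : ∀ q ∈ (lv T').offDiag, K ^ (d - T'.dist q.1 q.2) ≤
      (if q ∈ E then K ^ (d - T.dist q.1 q.2) else 0) + K ^ (d - s - 1) := by
    rintro ⟨a, b⟩ hq
    rw [Finset.mem_offDiag] at hq
    rcases H a hq.1 b hq.2.1 hq.2.2 with ⟨h1, h2, h4⟩ | h1
    · rw [if_pos (Finset.mem_offDiag.2 ⟨h1, h2, hq.2.2⟩)]
      have : K ^ (d - T'.dist a b) ≤ K ^ (d - T.dist a b) :=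
        Nat.pow_le_pow_right hKpos (by omega)
      exact this.trans (Nat.le_add_right _ _)
    · have : K ^ (d - T'.dist a b) ≤ K ^ (d - s - 1) :=
        Nat.pow_le_pow_right hKpos (by omega)
      exact this.trans (Nat.le_add_left _ _)
  have h1 := Finset.sum_le_sum hbound
  rw [Finset.sum_add_distrib, Finset.sum_const, ← Finset.sum_filter, smul_eq_mul] at h1
  have h2 : ∑ q ∈ (lv T').offDiag with q ∈ E, K ^ (d - T.dist q.1 q.2) ≤
      ∑ q ∈ E, K ^ (d - T.dist q.1 q.2) :=
    Finset.sum_le_sum_of_subset (fun q hq => (Finset.mem_filter.1 hq).2)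
  have hnot : (x, y) ∉ E := by simp [hE]
  have hsub : insert (x, y) E ⊆ (lv T).offDiag := by
    intro q hq
    rcases Finset.mem_insert.1 hq with rfl | hq
    · exact Finset.mem_offDiag.2 ⟨hx, hy, hxy⟩
    · have := Finset.mem_offDiag.1 hq
      exact Finset.mem_offDiag.2 ⟨Finset.mem_of_mem_erase this.1, Finset.mem_of_mem_erase this.2.1,
        this.2.2⟩
  have h4 := Finset.sum_le_sum_of_subset (f := fun q : V × V => K ^ (d - T.dist q.1 q.2)) hsub
  rw [Finset.sum_insert hnot] at h4
  have h5 : K ^ (d - s) = K ^ (d - s - 1) * K := by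
    rw [← pow_succ]; congr 1; omega
  have h6 : (lv T').offDiag.card ≤ n ^ 2 := by
    have := Finset.card_le_univ (lv T').offDiag
    rw [Fintype.card_prod] at this
    rw [pow_two]; exact this
  have h7 : (lv T').offDiag.card * K ^ (d - s - 1) ≤ n ^ 2 * K ^ (d - s - 1) :=
    Nat.mul_le_mul_right _ h6
  have h8 : 0 < K ^ (d - s - 1) := Nat.pow_pos hKpos
  have h9 : K ^ (d - s) = n ^ 2 * K ^ (d - s - 1) + K ^ (d - s - 1) := by
    rw [h5, hK]; ring
  simp only [← hs'] at h4
  omega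

lemma final (G : SimpleGraph V) (d : ℕ) (hd : 4 ≤ d)
    (hconn : G.Connected) (hn : d < Fintype.card V)
    (hα : ∀ I : Finset V, (∀ u ∈ I, ∀ v ∈ I, ¬G.Adj u v) → I.card ≤ 5)
    (hδ : ∀ t : ℕ, 1 ≤ t → ∀ I : Finset V, (∀ u ∈ I, ∀ v ∈ I, ¬G.Adj u v) → I.card = 2 * t →
      t * (d - 2) < ({v : V | ∃ u ∈ I, G.Adj u v}).ncard) :
    ∃ T : SimpleGraph V, T ≤ G ∧ T.IsTree ∧
      ∀ u v : V, (T.neighborSet u).ncard = 1 → (T.neighborSet v).ncard = 1 → u ≠ v →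
        d ≤ T.dist u v := by
  classical
  obtain ⟨T₀, hT₀, hT₀'⟩ := hconn.exists_isTree_le
  obtain ⟨T₁, hT₁, hT₁m⟩ := Set.exists_min_image {T : SimpleGraph V | T ≤ G ∧ T.IsTree}
    (fun T => (lv T).card) (Set.toFinite _) ⟨T₀, hT₀, hT₀'⟩
  obtain ⟨T, hm, hTm⟩ := Set.exists_min_image {T : SimpleGraph V | MinT G T}
    (fun T => Phi d T) (Set.toFinite _) ⟨T₁, hT₁.1, hT₁.2, fun T' h h' => hT₁m T' ⟨h, h'⟩⟩
  have hm : MinT G T := hm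
  have hT := hm.tree
  refine ⟨T, hm.le, hT, ?_⟩
  by_contra! hcon
  obtain ⟨x₀, y₀, hx₀, hy₀, hne₀, hlt₀⟩ := hcon
  obtain ⟨⟨x, y⟩, hxy', hmin⟩ := Finset.exists_min_image (lv T).offDiag (fun q => T.dist q.1 q.2)
    ⟨(x₀, y₀), Finset.mem_offDiag.2 ⟨mem_lv.2 hx₀, mem_lv.2 hy₀, hne₀⟩⟩
  obtain ⟨hx, hy, hxy⟩ := Finset.mem_offDiag.1 hxy'
  have hmins : ∀ a ∈ lv T, ∀ b ∈ lv T, a ≠ b → T.dist x y ≤ T.dist a b := fun a ha b hb hab =>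
    hmin (a, b) (Finset.mem_offDiag.2 ⟨ha, hb, hab⟩)
  have hs : T.dist x y < d := (hmins x₀ (mem_lv.2 hx₀) y₀ (mem_lv.2 hy₀) hne₀).trans_lt hlt₀
  simp only at hx hy hxy
  obtain ⟨P, hxP, hyP, hPc, hPr, hPi, hPx, hPy, -⟩ := path_ex (hT.connected x y) hxy
  have h3 : 3 ≤ (lv T).card := by
    have : ∃ u, u ∉ P := by
      by_contra! hall
      rw [Finset.eq_univ_iff_forall.2 hall, Finset.card_univ] at hPc
      omega
    obtain ⟨u, hu⟩ := this
    obtain ⟨o, p, hoP, hpP, hop, -⟩ := boundary hT.connected (S := (P : Set V)) hu hxP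
    obtain ⟨z, hz, hpz⟩ := leaf_side hT hop
    have hle : res T P ≤ del T o p := res_le_del (fun h => hpP h.2)
    have hz' : ∀ w ∈ P, w ≠ z := by
      rintro w hw rfl
      exact not_reach hT hop ((((hPr o hoP).symm.trans (hPr w hw)).mono hle).trans hpz.symm)
    have hsub : ({x, y, z} : Finset V) ⊆ lv T := by
      intro w hw
      simp only [Finset.mem_insert, Finset.mem_singleton] at hw
      rcases hw with rfl | rfl | rfl <;> assumption
    have := Finset.card_le_card hsub
    rwa [Finset.card_eq_three.2 ⟨x, y, z, hxy, hz' x hxP, hz' y hyP, rfl⟩] at this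
  have hind := leaf_indep hm h3
  have hδ2 : ∀ I : Finset V, (∀ u ∈ I, ∀ v ∈ I, ¬G.Adj u v) → I.card = 4 →
      2 * (d - 2) < ({v : V | ∃ u ∈ I, G.Adj u v}).ncard := fun I h h' => hδ 2 (by omega) I h h'
  have hv : ∃ v, v ∉ P ∧ (G.Adj x v ∨ G.Adj y v) := by
    by_contra! hall
    have hI : ∀ u ∈ ({x, y} : Finset V), ∀ v ∈ ({x, y} : Finset V), ¬ G.Adj u v := by
      have : ∀ u ∈ ({x, y} : Finset V), u ∈ lv T := by
        intro u hu
        simp only [Finset.mem_insert, Finset.mem_singleton] at hu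
        rcases hu with rfl | rfl <;> assumption
      exact fun u hu v hv => hind u (this u hu) v (this v hv)
    have hN := hδ 1 le_rfl {x, y} hI (by simp [Finset.card_pair hxy])
    have hNs : {v : V | ∃ u ∈ ({x, y} : Finset V), G.Adj u v} ⊆
        ((P \ {x, y} : Finset V) : Set V) := by
      rintro w ⟨u, hu, huw⟩
      rw [Finset.mem_coe, Finset.mem_sdiff]
      refine ⟨?_, fun hw => hI u hu w hw huw⟩
      by_contra hw
      simp only [Finset.mem_insert, Finset.mem_singleton] at hu
      rcases hu with rfl | rfl
      · exact (hall w hw).1 huw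
      · exact (hall w hw).2 huw
    have hNc := Set.ncard_le_ncard hNs (Set.toFinite _)
    have hsub2 : ({x, y} : Finset V) ⊆ P := by
      intro u hu
      simp only [Finset.mem_insert, Finset.mem_singleton] at hu
      rcases hu with rfl | rfl <;> assumption
    rw [Set.ncard_coe_finset, Finset.card_sdiff_of_subset hsub2, Finset.card_pair hxy] at hNc
    omega
  obtain ⟨v, hvP, hv⟩ := hv
  have : ∃ T', MinT G T' ∧ Phi d T' < Phi d T := by
    rcases hv with hv | hv
    · exact improve hd hα hδ2 hm h3 hx hy hxy hs hxP hyP hPc hPr hPi hPx hPy hmins hvP hv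
    · rw [SimpleGraph.dist_comm (u := x)] at hs hPc
      refine improve hd hα hδ2 hm h3 hy hx hxy.symm hs hyP hxP hPc
        (fun u hu => (hPr y hyP).symm.trans (hPr u hu)) (fun u hu h h' => hPi u hu h' h) hPy hPx
        (fun a ha b hb hab => ?_) hvP hv
      rw [SimpleGraph.dist_comm (u := y)]; exact hmins a ha b hb hab
  obtain ⟨T', hT', hlt⟩ := this
  exact absurd (hTm T' hT') (not_le.2 hlt)

end fin
end LD

theorem stmt_19 {V : Type*} [Fintype V] (G : SimpleGraph V) (d : ℕ) (hd : 4 ≤ d)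
    (hconn : G.Connected) (hn : d < Fintype.card V)
    (hα : ∀ I : Finset V, IsIndepSet' G I → I.card ≤ 5)
    (hδ : ∀ t : ℕ, 1 ≤ t → ∀ I : Finset V, IsIndepSet' G I → I.card = 2 * t →
      t * (d - 2) < (nbhd G I).ncard) :
    ∃ T : SimpleGraph V, T ≤ G ∧ T.IsTree ∧
      ∀ u v : V, (T.neighborSet u).ncard = 1 → (T.neighborSet v).ncard = 1 → u ≠ v →
        d ≤ T.dist u v :=
  LD.final G d hd hconn hn hα hδ
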